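/- There exists ε > 0 such that ω(G) > 1 + ε for every finitely generated metabelian group G that is not polycyclic; in fact, every such group satisfies ω(G) ≥ 2^{1/48}. -/

import Mathlib

section GrowthDefs

variable {G : Type*} [Group G]

/-- The ball of radius `n` w.r.t. a finite set `X`: all elements of `G` that are products
of at most `n` letters from `X ∪ X⁻¹`. -/
def wordBall (X : Finset G) (n : ℕ) : Set G :=
  {g | ∃ l : List G, l.length ≤ n ∧ (∀ x ∈ l, x ∈ X ∨ x⁻¹ ∈ X) ∧ l.prod = g}

/-- The growth function `γ_G^X(n) = card {g ∈ G : ‖g‖_X ≤ n}`. -/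
noncomputable def growthFn (X : Finset G) (n : ℕ) : ℕ :=
  Nat.card (wordBall X n)

/-- The exponential growth rate `ω(G,X) = lim_{n→∞} γ_G^X(n)^{1/n}`, which by
submultiplicativity of the growth function equals `inf_{n ≥ 1} γ_G^X(n)^{1/n}`. -/
noncomputable def growthRateX (X : Finset G) : ℝ :=
  ⨅ n : ℕ, (growthFn X (n + 1) : ℝ) ^ ((1 : ℝ) / (n + 1))

/-- The minimal exponential growth rate `ω(G) = inf_X ω(G,X)`, the infimum being taken
over all finite generating sets `X` of `G`. -/
noncomputable def minGrowthRate (G : Type*) [Group G] : ℝ :=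
  sInf {r : ℝ | ∃ X : Finset G, Subgroup.closure (X : Set G) = ⊤ ∧ r = growthRateX X}

/-- `G` has exponential growth: `ω(G,X) > 1` for some (equivalently, every) finite
generating set `X`. -/
def HasExponentialGrowth (G : Type*) [Group G] : Prop :=
  ∃ X : Finset G, Subgroup.closure (X : Set G) = ⊤ ∧ 1 < growthRateX X

end GrowthDefs

/-- A group `G` is polycyclic if it admits a finite subnormal series
`1 = P_k ⊴ P_{k-1} ⊴ … ⊴ P_0 = G` with all quotients `P_{i-1}/P_i` cyclic: each term
is normal in the next one and the corresponding quotient is generated by the image of a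
single element `g`. -/
def IsPolycyclic (G : Type*) [Group G] : Prop :=
  ∃ (n : ℕ) (P : Fin (n + 1) → Subgroup G),
    P 0 = ⊥ ∧ P (Fin.last n) = ⊤ ∧
    ∀ i : Fin n,
      P i.castSucc ≤ P i.succ ∧
      (∀ x ∈ P i.succ, ∀ h ∈ P i.castSucc, x * h * x⁻¹ ∈ P i.castSucc) ∧
      (∃ g ∈ P i.succ, ∀ x ∈ P i.succ, ∃ k : ℤ, (g ^ k)⁻¹ * x ∈ P i.castSucc)

/-- A group is virtually polycyclic if it has a polycyclic subgroup of finite index. -/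
def IsVirtuallyPolycyclic (G : Type*) [Group G] : Prop :=
  ∃ H : Subgroup G, H.FiniteIndex ∧ IsPolycyclic H

universe u

section Growth

open scoped Pointwise

variable {G : Type*} [Group G]

lemma wordBall_add_subset (X : Finset G) (m n : ℕ) :
    wordBall X (m + n) ⊆ wordBall X m * wordBall X n := by
  rintro _ ⟨l, hl, hX, rfl⟩
  refine ⟨_, ⟨l.take m, by simp, fun x hx => hX x (List.mem_of_mem_take hx), rfl⟩,
    _, ⟨l.drop m, by simp; omega, fun x hx => hX x (List.mem_of_mem_drop hx), rfl⟩, ?_⟩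
  exact l.prod_take_mul_prod_drop m

lemma mul_mem_wordBall {X : Finset G} {m n : ℕ} {g h : G} (hg : g ∈ wordBall X m)
    (hh : h ∈ wordBall X n) : g * h ∈ wordBall X (m + n) := by
  obtain ⟨l, hl, hX, rfl⟩ := hg
  obtain ⟨l', hl', hX', rfl⟩ := hh
  refine ⟨l ++ l', by simp; omega, fun x hx => ?_, by simp⟩
  rcases List.mem_append.1 hx with hx | hx
  exacts [hX x hx, hX' x hx]

lemma wordBall_mono (X : Finset G) {m n : ℕ} (h : m ≤ n) : wordBall X m ⊆ wordBall X n :=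
  fun _ ⟨l, hl, hX, hp⟩ => ⟨l, hl.trans h, hX, hp⟩

lemma wordBall_zero (X : Finset G) : wordBall X 0 = {1} := by
  ext g
  constructor
  · rintro ⟨l, hl, -, rfl⟩
    simp [List.length_eq_zero_iff.1 (Nat.le_zero.1 hl)]
  · rintro rfl
    exact ⟨[], by simp⟩

lemma mem_wordBall_one {X : Finset G} {x : G} (hx : x ∈ X ∨ x⁻¹ ∈ X) : x ∈ wordBall X 1 :=
  ⟨[x], by simpa using hx⟩

lemma wordBall_one_subset (X : Finset G) : wordBall X 1 ⊆ {1} ∪ (↑X ∪ (↑X)⁻¹) := by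
  rintro _ ⟨l, hl, hX, rfl⟩
  match l, hl with
  | [], _ => simp
  | [x], _ => simpa using Or.inr (hX x (by simp))

lemma finite_wordBall (X : Finset G) (n : ℕ) : (wordBall X n).Finite := by
  induction n with
  | zero => simp [wordBall_zero]
  | succ n ih =>
    have h1 : (wordBall X 1).Finite :=
      ((Set.finite_singleton 1).union (X.finite_toSet.union X.finite_toSet.inv)).subset
        (wordBall_one_subset X)
    exact (ih.mul h1).subset (wordBall_add_subset X n 1)

lemma growthFn_add_le (X : Finset G) (m n : ℕ) :
    growthFn X (m + n) ≤ growthFn X m * growthFn X n :=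
  (Nat.card_mono ((finite_wordBall X m).mul (finite_wordBall X n))
    (wordBall_add_subset X m n)).trans Set.natCard_mul_le

lemma growthFn_mul_le (X : Finset G) (m k : ℕ) : growthFn X (m * k) ≤ growthFn X m ^ k := by
  induction k with
  | zero => simp [growthFn, wordBall_zero]
  | succ k ih =>
    rw [Nat.mul_succ, pow_succ]
    exact (growthFn_add_le X _ _).trans (Nat.mul_le_mul_right _ ih)

lemma le_growthRateX_of_two_pow_le {X : Finset G} {L : ℕ} (hL : L ≠ 0)
    (h : ∀ n, 2 ^ n ≤ growthFn X (L * n)) : (2 : ℝ) ^ ((1 : ℝ) / L) ≤ growthRateX X := by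
  refine le_ciInf fun n => ?_
  have hle : (2 : ℝ) ^ (n + 1) ≤ (growthFn X (n + 1) : ℝ) ^ L := by
    have := (h (n + 1)).trans (mul_comm L (n + 1) ▸ growthFn_mul_le X (n + 1) L)
    exact_mod_cast this
  have hL' : (0 : ℝ) < L := by positivity
  have hn : (0 : ℝ) < (n : ℝ) + 1 := by positivity
  have key := Real.rpow_le_rpow (by positivity) hle
    (by positivity : (0 : ℝ) ≤ 1 / L * (1 / ((n : ℝ) + 1)))
  rw [← Real.rpow_natCast, ← Real.rpow_natCast, ← Real.rpow_mul (by positivity),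
    ← Real.rpow_mul (by positivity)] at key
  have h1 : ((n + 1 : ℕ) : ℝ) * (1 / L * (1 / ((n : ℝ) + 1))) = 1 / L := by
    push_cast
    field_simp
  have h2 : (L : ℝ) * (1 / L * (1 / ((n : ℝ) + 1))) = 1 / ((n : ℝ) + 1) := by
    field_simp
  rwa [h1, h2] at key

/-- If no conjugate `t ^ n * a * t⁻ⁿ` lies in the subgroup generated by the preceding ones, then
`t` and `a * t` freely generate a free semigroup. -/
lemma two_pow_le_growthFn {X : Finset G} {L : ℕ} {t a : G} (ht : t ∈ wordBall X L)
    (hat : a * t ∈ wordBall X L)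
    (h : ∀ n : ℕ, t ^ n * a * (t ^ n)⁻¹ ∉
      Subgroup.closure ((fun i : ℕ => t ^ i * a * (t ^ i)⁻¹) '' Set.Iio n)) (n : ℕ) :
    2 ^ n ≤ growthFn X (L * n) := by
  classical
  let H : ℕ → Subgroup G := fun n =>
    Subgroup.closure ((fun i : ℕ => t ^ i * a * (t ^ i)⁻¹) '' Set.Iio n)
  have hmono : ∀ n, H n ≤ H (n + 1) := fun n =>
    Subgroup.closure_mono (Set.image_mono (Set.Iio_subset_Iio n.le_succ))
  have hmem : ∀ n, t ^ n * a * (t ^ n)⁻¹ ∈ H (n + 1) := fun n =>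
    Subgroup.subset_closure ⟨n, by simp, rfl⟩
  obtain ⟨D, hcard, hball, -⟩ : ∃ D : Finset G, D.card = 2 ^ n ∧ ↑D ⊆ wordBall X (L * n) ∧
      ∀ d ∈ D, d * (t ^ n)⁻¹ ∈ H n := by
    induction n with
    | zero => exact ⟨{1}, by simp, by simp [wordBall_zero], by simp [one_mem]⟩
    | succ n ih =>
      obtain ⟨D, hcard, hball, hD⟩ := ih
      refine ⟨D.image (· * t) ∪ D.image (· * (a * t)), ?_, ?_, ?_⟩
      · rw [Finset.card_union_of_disjoint, Finset.card_image_of_injective _ (mul_left_injective _),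
          Finset.card_image_of_injective _ (mul_left_injective _), hcard, pow_succ, mul_two]
        rw [Finset.disjoint_left]
        intro x hx hx'
        obtain ⟨d, hd, rfl⟩ := Finset.mem_image.1 hx
        obtain ⟨d', hd', he⟩ := Finset.mem_image.1 hx'
        have he' : d' * a = d := by simpa [← mul_assoc] using he
        subst he'
        apply h n
        have := (H n).mul_mem ((H n).inv_mem (hD _ hd')) (hD _ hd)
        convert this using 1
        group
      · rw [Nat.mul_succ]
        intro x hx
        simp only [Finset.coe_union, Finset.coe_image, Set.mem_union, Set.mem_image] at hx
        rcases hx with ⟨d, hd, rfl⟩ | ⟨d, hd, rfl⟩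
        · exact mul_mem_wordBall (hball hd) ht
        · exact mul_mem_wordBall (hball hd) hat
      · intro x hx
        simp only [Finset.mem_union, Finset.mem_image] at hx
        rcases hx with ⟨d, hd, rfl⟩ | ⟨d, hd, rfl⟩
        · convert hmono n (hD d hd) using 1
          rw [pow_succ]
          group
        · convert (H (n + 1)).mul_mem (hmono n (hD d hd)) (hmem n) using 1
          rw [pow_succ]
          group
  rw [← hcard, growthFn, ← Set.ncard_coe_finset D]
  exact Set.ncard_le_ncard hball (finite_wordBall X _)

end Growth

open scoped commutatorElement

section Polycyclic

variable {G : Type*} [Group G]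

/-- `H` is obtained from the trivial subgroup by successively adjoining elements normalizing the
subgroup constructed so far. -/
inductive HasCyclicSeries : Subgroup G → Prop
  | bot : HasCyclicSeries ⊥
  | sup_zpowers {H : Subgroup G} {g : G} : HasCyclicSeries H →
      g ∈ Subgroup.normalizer (H : Set G) → HasCyclicSeries (H ⊔ Subgroup.zpowers g)

lemma HasCyclicSeries.exists_series {K : Subgroup G} (hK : HasCyclicSeries K) :
    ∃ (n : ℕ) (P : Fin (n + 1) → Subgroup G),
      P 0 = ⊥ ∧ P (Fin.last n) = K ∧
      ∀ i : Fin n,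
        P i.castSucc ≤ P i.succ ∧
        (∀ x ∈ P i.succ, ∀ h ∈ P i.castSucc, x * h * x⁻¹ ∈ P i.castSucc) ∧
        (∃ g ∈ P i.succ, ∀ x ∈ P i.succ, ∃ k : ℤ, (g ^ k)⁻¹ * x ∈ P i.castSucc) := by
  induction hK with
  | bot => exact ⟨0, fun _ => ⊥, rfl, rfl, fun i => i.elim0⟩
  | @sup_zpowers H g _ hg ih =>
    obtain ⟨n, P, h0, hlast, hstep⟩ := ih
    have hzp : Subgroup.zpowers g ≤ Subgroup.normalizer (H : Set G) :=
      Subgroup.zpowers_le.2 hg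
    refine ⟨n + 1, Fin.snoc P (H ⊔ Subgroup.zpowers g), ?_, Fin.snoc_last _ _, fun i => ?_⟩
    · rw [← Fin.castSucc_zero, Fin.snoc_castSucc, h0]
    · induction i using Fin.lastCases with
      | cast i =>
        rw [Fin.succ_castSucc, Fin.snoc_castSucc, Fin.snoc_castSucc]
        exact hstep i
      | last =>
        rw [Fin.succ_last, Fin.snoc_last, Fin.snoc_castSucc, hlast]
        refine ⟨le_sup_left, fun x hx h hh => ?_, g,
          Subgroup.mem_sup_right (Subgroup.mem_zpowers g), fun x hx => ?_⟩
        · exact (Subgroup.mem_normalizer_iff.1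
            (sup_le Subgroup.le_normalizer hzp hx) h).1 hh
        · rw [sup_comm, ← SetLike.mem_coe,
            Subgroup.coe_mul_of_left_le_normalizer_right _ _ hzp] at hx
          obtain ⟨_, ⟨k, rfl⟩, h, hh, rfl⟩ := hx
          exact ⟨k, by simpa using hh⟩

lemma hasCyclicSeries_sup_closure {H : Subgroup G} (hH : HasCyclicSeries H) (F : Finset G)
    (hn : ∀ E ⊆ F, ∀ g ∈ F,
      g ∈ Subgroup.normalizer ((H ⊔ Subgroup.closure (E : Set G) : Subgroup G) : Set G)) :
    HasCyclicSeries (H ⊔ Subgroup.closure (F : Set G)) := by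
  classical
  induction F using Finset.induction_on with
  | empty => simpa using hH
  | insert g F _ ih =>
    have h1 := ih fun E hE x hx =>
      hn E (hE.trans (Finset.subset_insert _ _)) x (Finset.mem_insert_of_mem hx)
    have h2 := h1.sup_zpowers (hn F (Finset.subset_insert _ _) g (Finset.mem_insert_self _ _))
    rw [Finset.coe_insert, Set.insert_eq, Set.union_comm, Subgroup.closure_union, ← sup_assoc,
      ← Subgroup.zpowers_eq_closure]
    exact h2

lemma normal_of_commutator_le {H : Subgroup G} (h : commutator G ≤ H) : H.Normal where
  conj_mem x hx g := by
    have h1 : ⁅g, x⁆ ∈ H :=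
      h (Subgroup.commutator_mem_commutator (Subgroup.mem_top g) (Subgroup.mem_top x))
    simpa [commutatorElement_def] using H.mul_mem h1 hx

lemma isPolycyclic_of_fg_commutator (hG : Group.FG G)
    (hA : ∀ x ∈ commutator G, ∀ y ∈ commutator G, x * y = y * x)
    (hfg : (commutator G).FG) : IsPolycyclic G := by
  obtain ⟨F, hF⟩ := hfg
  obtain ⟨S, hS⟩ := Group.fg_def.1 hG
  have h1 : HasCyclicSeries (commutator G) := by
    have := hasCyclicSeries_sup_closure (HasCyclicSeries.bot (G := G)) F fun E hE g hg => by
      have hle : Subgroup.closure (E : Set G) ≤ commutator G :=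
        hF ▸ Subgroup.closure_mono (Finset.coe_subset.2 hE)
      have hg' : g ∈ commutator G := hF ▸ Subgroup.subset_closure hg
      rw [bot_sup_eq]
      refine Subgroup.centralizer_le_normalizer _ (Subgroup.mem_centralizer_iff.2 fun x hx => ?_)
      exact hA x (hle hx) g hg'
    rwa [bot_sup_eq, hF] at this
  have h2 := hasCyclicSeries_sup_closure h1 S fun E _ g _ => by
    have := normal_of_commutator_le
      (le_sup_left : commutator G ≤ commutator G ⊔ Subgroup.closure (E : Set G))
    rw [Subgroup.normalizer_eq_top]
    exact Subgroup.mem_top g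
  rw [hS, sup_top_eq] at h2
  exact h2.exists_series

end Polycyclic

section ConjInvariant

variable {G : Type*} [Group G]

/-- A normal subgroup contains the derived subgroup as soon as it contains the commutators of
generators. -/
lemma commutator_le_of_forall_generators {X : Set G} (hX : Subgroup.closure X = ⊤)
    {N : Subgroup G} [N.Normal] (h : ∀ x ∈ X, ∀ y ∈ X, ⁅x, y⁆ ∈ N) : commutator G ≤ N := by
  have hq : ∀ x y : G, ⁅x, y⁆ ∈ N ↔ (x : G ⧸ N) * y = y * x := fun x y => by
    rw [← QuotientGroup.eq_one_iff, ← commutatorElement_eq_one_iff_mul_comm]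
    rfl
  simp only [hq] at h
  have h1 : ∀ x ∈ X, ∀ g : G, (x : G ⧸ N) * g = g * x := by
    intro x hx g
    have hg : g ∈ Subgroup.closure X := hX ▸ Subgroup.mem_top g
    have : Subgroup.closure X ≤
        (Subgroup.centralizer {(x : G ⧸ N)}).comap (QuotientGroup.mk' N) := by
      rw [Subgroup.closure_le]
      intro y hy
      simpa [Subgroup.mem_centralizer_iff] using h x hx y hy
    simpa [Subgroup.mem_centralizer_iff] using this hg
  have h2 : Subgroup.closure X ≤ (Subgroup.center (G ⧸ N)).comap (QuotientGroup.mk' N) := by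
    rw [Subgroup.closure_le]
    intro x hx
    simp only [Subgroup.coe_comap, Set.mem_preimage, SetLike.mem_coe, Subgroup.mem_center_iff]
    intro q
    obtain ⟨g, rfl⟩ := QuotientGroup.mk_surjective q
    exact (h1 x hx g).symm
  rw [commutator_def, Subgroup.commutator_le]
  intro x _ y _
  have hx : x ∈ Subgroup.closure X := hX ▸ Subgroup.mem_top x
  rw [hq]
  exact (Subgroup.mem_center_iff.1 (h2 hx) y).symm

lemma fg_map {G' : Type*} [Group G'] {H : Subgroup G} (hH : H.FG) (f : G →* G') :
    (H.map f).FG := by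
  obtain ⟨S, rfl⟩ := hH
  rw [MonoidHom.map_closure]
  exact (Subgroup.fg_iff _).2 ⟨_, rfl, S.finite_toSet.image f⟩

lemma fg_of_le_of_commute {H K : Subgroup G} (hK : K.FG)
    (hc : ∀ x ∈ K, ∀ y ∈ K, x * y = y * x) (h : H ≤ K) : H.FG := by
  let : CommGroup K := { (inferInstance : Group K) with
    mul_comm := fun x y => Subtype.ext (hc x x.2 y y.2) }
  have : Group.FG K := (Group.fg_iff_subgroup_fg K).2 hK
  have : Module.Finite ℤ (Additive K) :=
    Module.Finite.iff_addGroup_fg.2 (GroupFG.iff_add_fg.1 inferInstance)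
  have h1 : (H.subgroupOf K).FG := by
    rw [Subgroup.fg_iff_add_fg, ← AddSubgroup.toIntSubmodule_toAddSubgroup
      (H.subgroupOf K).toAddSubgroup, ← Submodule.fg_iff_addSubgroup_fg]
    exact IsNoetherian.noetherian _
  have h2 := fg_map h1 K.subtype
  rwa [Subgroup.map_subgroupOf_eq_of_le h] at h2

/-- `B` is mapped into itself by conjugation by `t`. -/
def ConjInvariant (t : G) (B : Subgroup G) : Prop :=
  B.map (MulAut.conj t).toMonoidHom ≤ B

lemma ConjInvariant.conj_mem {t b : G} {B : Subgroup G} (h : ConjInvariant t B) (hb : b ∈ B) :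
    t * b * t⁻¹ ∈ B :=
  h ⟨b, hb, rfl⟩

lemma ConjInvariant.sup {t : G} {B C : Subgroup G} (hB : ConjInvariant t B)
    (hC : ConjInvariant t C) : ConjInvariant t (B ⊔ C) := by
  rw [ConjInvariant, Subgroup.map_sup]
  exact sup_le_sup hB hC

lemma normal_of_conjInvariant {X : Set G} (hX : Subgroup.closure X = ⊤) {B : Subgroup G}
    (h : ∀ x ∈ X, ConjInvariant x B) (h' : ∀ x ∈ X, ConjInvariant x⁻¹ B) : B.Normal := by
  rw [← Subgroup.normalizer_eq_top_iff, ← top_le_iff, ← hX, Subgroup.closure_le]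
  intro x hx
  refine Subgroup.mem_normalizer_iff.2 fun b => ⟨(h x hx).conj_mem, fun hb => ?_⟩
  convert (h' x hx).conj_mem hb using 1
  group

lemma map_conj_comm (hA : ∀ x ∈ commutator G, ∀ y ∈ commutator G, x * y = y * x)
    {B : Subgroup G} (hB : B ≤ commutator G) (s t : G) :
    (B.map (MulAut.conj t).toMonoidHom).map (MulAut.conj s).toMonoidHom =
      (B.map (MulAut.conj s).toMonoidHom).map (MulAut.conj t).toMonoidHom := by
  rw [Subgroup.map_map, Subgroup.map_map]
  ext x
  have key : ∀ b ∈ B, s * (t * b * t⁻¹) * s⁻¹ = t * (s * b * s⁻¹) * t⁻¹ := by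
    intro b hb
    have hc : ⁅t⁻¹, s⁻¹⁆ ∈ commutator G :=
      Subgroup.commutator_mem_commutator (Subgroup.mem_top _) (Subgroup.mem_top _)
    have h1 := hA _ hc _ (hB hb)
    rw [commutatorElement_def] at h1
    calc s * (t * b * t⁻¹) * s⁻¹
        = s * t * (b * (t⁻¹ * s⁻¹ * t⁻¹⁻¹ * s⁻¹⁻¹)) * s⁻¹ * t⁻¹ := by group
      _ = t * (s * b * s⁻¹) * t⁻¹ := by rw [← h1]; group
  constructor
  · rintro ⟨b, hb, rfl⟩
    exact ⟨b, hb, (key b hb).symm⟩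
  · rintro ⟨b, hb, rfl⟩
    exact ⟨b, hb, key b hb⟩

/-- The elements of the derived subgroup contained in a finitely generated
`t`-invariant subgroup of the derived subgroup form a subgroup. -/
def finiteOrbitSubgroup (t : G) : Subgroup G where
  carrier := {b | ∃ B ≤ commutator G, B.FG ∧ ConjInvariant t B ∧ b ∈ B}
  one_mem' := ⟨⊥, bot_le, Subgroup.FG.bot, by simp [ConjInvariant], one_mem _⟩
  mul_mem' := by
    rintro a b ⟨B, hB, hf, hi, ha⟩ ⟨C, hC, hf', hi', hb⟩
    exact ⟨B ⊔ C, sup_le hB hC, hf.sup hf', hi.sup hi', Subgroup.mul_mem_sup ha hb⟩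
  inv_mem' := by
    rintro a ⟨B, hB, hf, hi, ha⟩
    exact ⟨B, hB, hf, hi, inv_mem ha⟩

lemma finiteOrbitSubgroup_normal
    (hA : ∀ x ∈ commutator G, ∀ y ∈ commutator G, x * y = y * x) (t : G) :
    (finiteOrbitSubgroup t).Normal where
  conj_mem := by
    rintro b ⟨B, hB, hf, hi, hb⟩ g
    refine ⟨B.map (MulAut.conj g).toMonoidHom, ?_, fg_map hf _, ?_, b, hb, rfl⟩
    · rintro _ ⟨c, hc, rfl⟩
      exact (inferInstance : (commutator G).Normal).conj_mem c (hB hc) g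
    · rw [ConjInvariant, map_conj_comm hA hB]
      exact Subgroup.map_mono hi

lemma exists_conjInvariant_of_fg {t : G} (h : commutator G ≤ finiteOrbitSubgroup t)
    {B : Subgroup G} (hB : B ≤ commutator G) (hf : B.FG) :
    ∃ C ≤ commutator G, C.FG ∧ ConjInvariant t C ∧ B ≤ C := by
  classical
  obtain ⟨F, rfl⟩ := hf
  induction F using Finset.induction_on with
  | empty => exact ⟨⊥, bot_le, Subgroup.FG.bot, by simp [ConjInvariant], by simp⟩
  | insert x F _ ih =>
    rw [Finset.coe_insert, Set.insert_eq, Subgroup.closure_union, sup_le_iff] at hB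
    obtain ⟨C, hC, hf, hi, hle⟩ := ih hB.2
    obtain ⟨D, hD, hf', hi', hx⟩ := h (hB.1 (Subgroup.subset_closure rfl))
    refine ⟨D ⊔ C, sup_le hD hC, hf'.sup hf, hi'.sup hi, ?_⟩
    rw [Finset.coe_insert, Set.insert_eq, Subgroup.closure_union]
    refine sup_le_sup ?_ hle
    simpa [Subgroup.closure_le] using hx

lemma exists_fg_forall_conjInvariant
    (hA : ∀ x ∈ commutator G, ∀ y ∈ commutator G, x * y = y * x) (S : Finset G)
    (h : ∀ t ∈ S, commutator G ≤ finiteOrbitSubgroup t)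
    {B : Subgroup G} (hB : B ≤ commutator G) (hf : B.FG) :
    ∃ C ≤ commutator G, C.FG ∧ (∀ t ∈ S, ConjInvariant t C) ∧ B ≤ C := by
  classical
  induction S using Finset.induction_on with
  | empty => exact ⟨B, hB, hf, by simp, le_rfl⟩
  | insert t S _ ih =>
    obtain ⟨C, hC, hCf, hi, hle⟩ := ih fun s hs => h s (Finset.mem_insert_of_mem hs)
    obtain ⟨D, hD, hDf, hDi, hCD⟩ :=
      exists_conjInvariant_of_fg (h t (Finset.mem_insert_self _ _)) hC hCf
    have hle' : ⨆ n : ℕ, C.map (MulAut.conj (t ^ n)).toMonoidHom ≤ D := by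
      refine iSup_le fun n => ?_
      induction n with
      | zero =>
        rintro _ ⟨c, hc, rfl⟩
        simpa using hCD hc
      | succ n ih =>
        rintro _ ⟨c, hc, rfl⟩
        convert hDi.conj_mem (ih ⟨c, hc, rfl⟩) using 1
        simp [pow_succ', mul_assoc]
    refine ⟨⨆ n : ℕ, C.map (MulAut.conj (t ^ n)).toMonoidHom, hle'.trans hD,
      fg_of_le_of_commute hDf (fun x hx y hy => hA x (hD hx) y (hD hy)) hle', ?_, ?_⟩
    · intro s hs
      rw [ConjInvariant, Subgroup.map_iSup]
      rcases Finset.mem_insert.1 hs with rfl | hs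
      · refine iSup_le fun n => le_iSup_of_le (n + 1) ?_
        rintro _ ⟨_, ⟨c, hc, rfl⟩, rfl⟩
        refine ⟨c, hc, ?_⟩
        simp [pow_succ', mul_assoc]
      · refine iSup_mono fun n => ?_
        rw [map_conj_comm hA hC]
        exact Subgroup.map_mono (hi s hs)
    · refine hle.trans (le_iSup_of_le 0 fun c hc => ⟨c, hc, by simp⟩)

lemma mem_finiteOrbitSubgroup {t a : G} (ha : a ∈ commutator G) {n : ℕ}
    (h : t ^ n * a * (t ^ n)⁻¹ ∈
      Subgroup.closure ((fun i : ℕ => t ^ i * a * (t ^ i)⁻¹) '' Set.Iio n)) :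
    a ∈ finiteOrbitSubgroup t := by
  set B := Subgroup.closure ((fun i : ℕ => t ^ i * a * (t ^ i)⁻¹) '' Set.Iio n) with hBdef
  have hmem : ∀ i ≤ n, t ^ i * a * (t ^ i)⁻¹ ∈ B := by
    intro i hi
    rcases hi.lt_or_eq with hi | rfl
    exacts [Subgroup.subset_closure ⟨i, hi, rfl⟩, h]
  refine ⟨B, ?_, (Subgroup.fg_iff B).2 ⟨_, rfl, (Set.finite_Iio n).image _⟩, ?_,
    by simpa using hmem 0 (Nat.zero_le n)⟩
  · rw [hBdef, Subgroup.closure_le]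
    rintro _ ⟨i, -, rfl⟩
    exact (inferInstance : (commutator G).Normal).conj_mem a ha (t ^ i)
  · rw [ConjInvariant, Subgroup.map_le_iff_le_comap]
    refine (Subgroup.closure_le _).2 ?_
    rintro _ ⟨i, hi, rfl⟩
    have := hmem (i + 1) hi
    simpa [pow_succ', mul_assoc] using this

end ConjInvariant

/-- The growth rate of a metabelian, non-polycyclic group is at least `2 ^ (1 / 5)` with respect
to every finite generating set. -/
theorem two_rpow_le_growthRateX {G : Type*} [Group G]
    (hA : ∀ x ∈ commutator G, ∀ y ∈ commutator G, x * y = y * x) (hpoly : ¬ IsPolycyclic G)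
    {X : Finset G} (hX : Subgroup.closure (X : Set G) = ⊤) :
    (2 : ℝ) ^ ((1 : ℝ) / 5) ≤ growthRateX X := by
  classical
  have hG : Group.FG G := Group.fg_def.2 ⟨X, hX⟩
  by_contra hlt
  apply hpoly
  apply isPolycyclic_of_fg_commutator hG hA
  have horbit : ∀ t, (t ∈ X ∨ t⁻¹ ∈ X) → commutator G ≤ finiteOrbitSubgroup t := by
    intro t ht
    have := finiteOrbitSubgroup_normal hA t
    refine commutator_le_of_forall_generators hX fun x hx y hy => ?_
    have hxy : ⁅x, y⁆ ∈ commutator G :=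
      Subgroup.commutator_mem_commutator (Subgroup.mem_top x) (Subgroup.mem_top y)
    by_contra hn
    apply hlt
    have ht1 := mem_wordBall_one ht
    have hx1 := mem_wordBall_one (X := X) (Or.inl hx)
    have hy1 := mem_wordBall_one (X := X) (Or.inl hy)
    have hx1' : x⁻¹ ∈ wordBall X 1 := mem_wordBall_one (Or.inr (by simpa using hx))
    have hy1' : y⁻¹ ∈ wordBall X 1 := mem_wordBall_one (Or.inr (by simpa using hy))
    have hat : ⁅x, y⁆ * t ∈ wordBall X 5 :=
      mul_mem_wordBall
        (mul_mem_wordBall (mul_mem_wordBall (mul_mem_wordBall hx1 hy1) hx1') hy1') ht1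
    have := le_growthRateX_of_two_pow_le (X := X) (L := 5) (by norm_num)
      (two_pow_le_growthFn (wordBall_mono X (by norm_num) ht1) hat
        fun n hmem => hn (mem_finiteOrbitSubgroup hxy hmem))
    exact_mod_cast this
  have hfin : (Set.image2 (fun x y : G => ⁅x, y⁆) (X : Set G) X).Finite :=
    X.finite_toSet.image2 _ X.finite_toSet
  obtain ⟨C, hC, hCf, hCi, hle⟩ := exists_fg_forall_conjInvariant hA (X ∪ X.image (·⁻¹))
    (fun t ht => horbit t (by
      rcases Finset.mem_union.1 ht with ht | ht
      · exact Or.inl ht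
      · obtain ⟨x, hx, rfl⟩ := Finset.mem_image.1 ht
        exact Or.inr (by simpa using hx)))
    (B := Subgroup.closure (Set.image2 (fun x y : G => ⁅x, y⁆) (X : Set G) X))
    (by
      rw [Subgroup.closure_le]
      rintro _ ⟨x, -, y, -, rfl⟩
      exact Subgroup.commutator_mem_commutator (Subgroup.mem_top x) (Subgroup.mem_top y))
    ((Subgroup.fg_iff _).2 ⟨_, rfl, hfin⟩)
  have hCn : C.Normal := normal_of_conjInvariant hX
    (fun x hx => hCi x (Finset.mem_union_left _ hx))
    (fun x hx => hCi x⁻¹ (Finset.mem_union_right _ (Finset.mem_image_of_mem _ hx)))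
  have : commutator G = C := le_antisymm
    (commutator_le_of_forall_generators hX fun x hx y hy =>
      hle (Subgroup.subset_closure ⟨x, hx, y, hy, rfl⟩)) hC
  rwa [this]

/-- **Theorem 2.4 (Osin).** There is `ε > 0` such that `ω(G) > 1 + ε` for every finitely
generated metabelian non-polycyclic group `G`; in fact every such group satisfies
`ω(G) ≥ 2^{1/48}`. -/
theorem metabelian_not_polycyclic_uniform_growth_gap :
    ∃ ε : ℝ, 0 < ε ∧
      ∀ (G : Type u) (inst : Group G), Group.FG G → derivedSeries G 2 = ⊥ →
        ¬ IsPolycyclic G →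
        1 + ε < minGrowthRate G ∧ (2 : ℝ) ^ ((1 : ℝ) / 48) ≤ minGrowthRate G := by
  have h48 : (1 : ℝ) < (2 : ℝ) ^ ((1 : ℝ) / 48) :=
    Real.one_lt_rpow (by norm_num) (by norm_num)
  refine ⟨((2 : ℝ) ^ ((1 : ℝ) / 48) - 1) / 2, by linarith, fun G inst hG hmet hpoly => ?_⟩
  have hA : ∀ x ∈ commutator G, ∀ y ∈ commutator G, x * y = y * x := by
    have h2 : ⁅commutator G, commutator G⁆ = ⊥ := by
      rw [← derivedSeries_one, ← derivedSeries_succ]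
      exact hmet
    intro x hx y hy
    exact ((Subgroup.mem_centralizer_iff.1
      (Subgroup.commutator_eq_bot_iff_le_centralizer.1 h2 hx)) y hy).symm
  have hmain : (2 : ℝ) ^ ((1 : ℝ) / 48) ≤ minGrowthRate G := by
    obtain ⟨X, hX⟩ := Group.fg_def.1 hG
    refine le_csInf ⟨_, X, hX, rfl⟩ ?_
    rintro _ ⟨Y, hY, rfl⟩
    refine le_trans ?_ (two_rpow_le_growthRateX hA hpoly hY)
    exact Real.rpow_le_rpow_of_exponent_le (by norm_num) (by norm_num)
  exact ⟨by linarith, hmain⟩
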